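/- Suppose the loss function w is bounded (there is M < ∞ with w(θ,d) ≤ M for all θ, d), and suppose that every stopping rule ψ with R(ψ) < ∞ satisfies P^{π₁}(τ_ψ < ∞) = 1, where P^{π₁}(τ_ψ < ∞) = Σₙ≥₁ ∫_Θ (∫ sₙ^ψ f_θⁿ dμⁿ) dπ₁(θ). Then every stopping rule ψ is truncatable, i.e. R_N(ψ) → R(ψ) as N → ∞. -/

import Mathlib

open MeasureTheory ENNReal Filter ProbabilityTheory

namespace SDP

variable {Θ X D : Type*} [MeasurableSpace Θ] [MeasurableSpace X] [MeasurableSpace D]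

/-- The product measure `μⁿ` on `Xⁿ`. -/
noncomputable def pm (μ : Measure X) (n : ℕ) : Measure (Fin n → X) :=
  Measure.pi fun _ => μ

/-- `t_n^ψ = (1-ψ₁)⋯(1-ψ_{n-1})`, with `t₁^ψ ≡ 1`. -/
noncomputable def t (ψ : ∀ n, (Fin n → X) → ℝ≥0∞) : ∀ n, (Fin n → X) → ℝ≥0∞
  | 0, _ => 1
  | 1, _ => 1
  | n + 2, x => t ψ (n + 1) (Fin.init x) * (1 - ψ (n + 1) (Fin.init x))

/-- `s_n^ψ = (1-ψ₁)⋯(1-ψ_{n-1})ψ_n`. -/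
noncomputable def s (ψ : ∀ n, (Fin n → X) → ℝ≥0∞) (n : ℕ) (x : Fin n → X) : ℝ≥0∞ :=
  t ψ n x * ψ n x

/-- A stopping rule: a sequence of measurable functions with values in `[0,1]`. -/
def IsStoppingRule (ψ : ∀ n, (Fin n → X) → ℝ≥0∞) : Prop :=
  (∀ n, Measurable (ψ n)) ∧ ∀ n x, ψ n x ≤ 1

/-- A decision rule: a sequence of measurable functions with values in `D`. -/
def IsDecisionRule (δ : ∀ n, (Fin n → X) → D) : Prop := ∀ n, Measurable (δ n)

/-- `ψ` is truncated at `N`: `ψ_n ≡ 1` for all `n ≥ N`. -/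
def TruncatedAt (ψ : ∀ n, (Fin n → X) → ℝ≥0∞) (N : ℕ) : Prop :=
  ∀ n, N ≤ n → ∀ x, ψ n x = 1

/-- A consistent family of joint probability densities `f_θⁿ` w.r.t. `μⁿ`. -/
def IsDensityFamily (μ : Measure X) (f : Θ → ∀ n, (Fin n → X) → ℝ≥0∞) : Prop :=
  (∀ n, Measurable fun p : Θ × (Fin n → X) => f p.1 n p.2) ∧
  (∀ θ x, f θ 0 x = 1) ∧
  (∀ θ n, ∫⁻ x, f θ n x ∂pm μ n = 1) ∧
  ∀ θ n (x : Fin n → X), ∫⁻ y, f θ (n + 1) (Fin.snoc x y) ∂μ = f θ n x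

/-- The average loss `W(ψ,δ)`. -/
noncomputable def W (π₁ : Measure Θ) (μ : Measure X) (w : Θ → D → ℝ≥0∞)
    (f : Θ → ∀ n, (Fin n → X) → ℝ≥0∞) (ψ : ∀ n, (Fin n → X) → ℝ≥0∞)
    (δ : ∀ n, (Fin n → X) → D) : ℝ≥0∞ :=
  ∑' n : ℕ, ∫⁻ θ, ∫⁻ x, s ψ (n + 1) x * w θ (δ (n + 1) x) * f θ (n + 1) x ∂pm μ (n + 1) ∂π₁

/-- The partial average loss `W_i(ψ,δ)` (integration over `Θᵢ`). -/
noncomputable def Wi (π₁ : Measure Θ) (μ : Measure X) (w : Θ → D → ℝ≥0∞)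
    (f : Θ → ∀ n, (Fin n → X) → ℝ≥0∞) (Θi : Set Θ) (ψ : ∀ n, (Fin n → X) → ℝ≥0∞)
    (δ : ∀ n, (Fin n → X) → D) : ℝ≥0∞ :=
  ∑' n : ℕ,
    ∫⁻ θ in Θi, ∫⁻ x, s ψ (n + 1) x * w θ (δ (n + 1) x) * f θ (n + 1) x ∂pm μ (n + 1) ∂π₁

/-- `P^{π}(τ_ψ = n)`. -/
noncomputable def PtauEq (π₂ : Measure Θ) (μ : Measure X)
    (f : Θ → ∀ n, (Fin n → X) → ℝ≥0∞) (ψ : ∀ n, (Fin n → X) → ℝ≥0∞) (n : ℕ) : ℝ≥0∞ :=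
  ∫⁻ θ, ∫⁻ x, s ψ n x * f θ n x ∂pm μ n ∂π₂

/-- `P^{π}(τ_ψ < ∞)`. -/
noncomputable def Pfin (π₂ : Measure Θ) (μ : Measure X)
    (f : Θ → ∀ n, (Fin n → X) → ℝ≥0∞) (ψ : ∀ n, (Fin n → X) → ℝ≥0∞) : ℝ≥0∞ :=
  ∑' n : ℕ, PtauEq π₂ μ f ψ (n + 1)

/-- The average sample number `N(ψ)` (equal to `∞` if `P^{π₂}(τ_ψ < ∞) < 1`). -/
noncomputable def ASN (π₂ : Measure Θ) (μ : Measure X)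
    (f : Θ → ∀ n, (Fin n → X) → ℝ≥0∞) (ψ : ∀ n, (Fin n → X) → ℝ≥0∞) : ℝ≥0∞ :=
  if Pfin π₂ μ f ψ = 1 then ∑' n : ℕ, ((n : ℝ≥0∞) + 1) * PtauEq π₂ μ f ψ (n + 1) else ⊤

/-- `fⁿ = ∫_Θ f_θⁿ dπ₂(θ)` (in particular `f⁰ ≡ 1`). -/
noncomputable def fbar (π₂ : Measure Θ) (f : Θ → ∀ n, (Fin n → X) → ℝ≥0∞)
    (n : ℕ) (x : Fin n → X) : ℝ≥0∞ :=
  ∫⁻ θ, f θ n x ∂π₂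

/-- `R(ψ) = Σₙ ∫ sₙ^ψ (c n fⁿ + lₙ) dμⁿ` if `P^{π₂}(τ_ψ<∞) = 1`, `∞` otherwise. -/
noncomputable def R (π₂ : Measure Θ) (μ : Measure X) (c : ℝ≥0∞)
    (f : Θ → ∀ n, (Fin n → X) → ℝ≥0∞) (l : ∀ n, (Fin n → X) → ℝ≥0∞)
    (ψ : ∀ n, (Fin n → X) → ℝ≥0∞) : ℝ≥0∞ :=
  if Pfin π₂ μ f ψ = 1 then
    ∑' n : ℕ, ∫⁻ x, s ψ (n + 1) x *
      (c * ((n : ℝ≥0∞) + 1) * fbar π₂ f (n + 1) x + l (n + 1) x) ∂pm μ (n + 1)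
  else ⊤

/-- `R_N(ψ)`, the risk of `ψ` truncated at `N`. -/
noncomputable def RN (π₂ : Measure Θ) (μ : Measure X) (c : ℝ≥0∞)
    (f : Θ → ∀ n, (Fin n → X) → ℝ≥0∞) (l : ∀ n, (Fin n → X) → ℝ≥0∞)
    (N : ℕ) (ψ : ∀ n, (Fin n → X) → ℝ≥0∞) : ℝ≥0∞ :=
  (∑ n ∈ Finset.range (N - 1), ∫⁻ x, s ψ (n + 1) x *
      (c * ((n : ℝ≥0∞) + 1) * fbar π₂ f (n + 1) x + l (n + 1) x) ∂pm μ (n + 1)) +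
  ∫⁻ x, t ψ N x * (c * (N : ℝ≥0∞) * fbar π₂ f N x + l N x) ∂pm μ N

/-- `Vₙᴺ`, defined backwards from `V_Nᴺ = l_N` by `Vₙᴺ = min{lₙ, Qₙᴺ}`. -/
noncomputable def V (μ : Measure X) (c : ℝ≥0∞) (fb l : ∀ n, (Fin n → X) → ℝ≥0∞)
    (N n : ℕ) (x : Fin n → X) : ℝ≥0∞ :=
  if h : n < N then
    min (l n x) (c * fb n x + ∫⁻ y, V μ c fb l N (n + 1) (Fin.snoc x y) ∂μ)
  else l n x
termination_by N - n
decreasing_by omega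

/-- `Qₙᴺ = c fⁿ + ∫ Vₙ₊₁ᴺ(⋅,y) dμ(y)`. -/
noncomputable def Q (μ : Measure X) (c : ℝ≥0∞) (fb l : ∀ n, (Fin n → X) → ℝ≥0∞)
    (N n : ℕ) (x : Fin n → X) : ℝ≥0∞ :=
  c * fb n x + ∫⁻ y, V μ c fb l N (n + 1) (Fin.snoc x y) ∂μ

/-- `Vₙ = lim_{N→∞} Vₙᴺ` (the sequence is nonincreasing in `N`, so the limit is the inf). -/
noncomputable def Vlim (μ : Measure X) (c : ℝ≥0∞) (fb l : ∀ n, (Fin n → X) → ℝ≥0∞)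
    (n : ℕ) (x : Fin n → X) : ℝ≥0∞ :=
  ⨅ N, V μ c fb l N n x

/-- `Qₙ = lim_{N→∞} Qₙᴺ = c fⁿ + ∫ Vₙ₊₁(⋅,y) dμ(y)`. -/
noncomputable def Qlim (μ : Measure X) (c : ℝ≥0∞) (fb l : ∀ n, (Fin n → X) → ℝ≥0∞)
    (n : ℕ) (x : Fin n → X) : ℝ≥0∞ :=
  c * fb n x + ∫⁻ y, Vlim μ c fb l (n + 1) (Fin.snoc x y) ∂μ

end SDP

namespace SDP

variable {Θ X : Type*} [MeasurableSpace Θ] [MeasurableSpace X]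

instance sigmaFinite_pm (μ : Measure X) [SigmaFinite μ] (n : ℕ) : SigmaFinite (pm μ n) := by
  unfold pm; infer_instance

/-- Tonelli's theorem on `X^{n+1}`, integrating the last coordinate first. -/
lemma lintegral_pm_succ (μ : Measure X) [SigmaFinite μ] (n : ℕ)
    {g : (Fin (n + 1) → X) → ℝ≥0∞} (hg : Measurable g) :
    ∫⁻ x, g x ∂pm μ (n + 1) = ∫⁻ x, ∫⁻ y, g (Fin.snoc x y) ∂μ ∂pm μ n := by
  have h := (measurePreserving_piFinSuccAbove (fun _ : Fin (n + 1) => μ) (Fin.last n)).symm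
  unfold pm
  have hm : Measurable fun z =>
      g ((MeasurableEquiv.piFinSuccAbove (fun _ => X) (Fin.last n)).symm z) :=
    hg.comp h.measurable
  rw [← h.lintegral_comp hg, lintegral_prod_symm _ hm.aemeasurable]
  refine lintegral_congr fun x => lintegral_congr fun y => ?_
  simp [MeasurableEquiv.piFinSuccAbove, Fin.insertNthEquiv, Fin.insertNth_last']

lemma measurable_t {ψ : ∀ n, (Fin n → X) → ℝ≥0∞} (hψ : IsStoppingRule ψ) :
    ∀ n, Measurable (t ψ n)
  | 0 => measurable_const
  | 1 => measurable_const
  | n + 2 => by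
    have hi : Measurable (Fin.init : (Fin (n + 2) → X) → Fin (n + 1) → X) :=
      measurable_pi_lambda _ fun i => measurable_pi_apply _
    exact ((measurable_t hψ (n + 1)).comp hi).mul
      (measurable_const.sub ((hψ.1 (n + 1)).comp hi))

/-- `P^π(τ_ψ ≥ n)`. -/
noncomputable def PtauGe (π : Measure Θ) (μ : Measure X)
    (f : Θ → ∀ n, (Fin n → X) → ℝ≥0∞) (ψ : ∀ n, (Fin n → X) → ℝ≥0∞) (n : ℕ) : ℝ≥0∞ :=
  ∫⁻ θ, ∫⁻ x, t ψ n x * f θ n x ∂pm μ n ∂π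

section

variable {μ : Measure X} {f : Θ → ∀ n, (Fin n → X) → ℝ≥0∞}
  {ψ : ∀ n, (Fin n → X) → ℝ≥0∞}

lemma IsDensityFamily.measurable_apply (hf : IsDensityFamily μ f) (θ : Θ) (n : ℕ) :
    Measurable (f θ n) :=
  (hf.1 n).comp measurable_prodMk_left

lemma IsDensityFamily.measurable_fbar (hf : IsDensityFamily μ f) (π : Measure Θ)
    [SFinite π] (n : ℕ) : Measurable (fbar π f n) :=
  (hf.1 n).lintegral_prod_left'

lemma PtauGe_one (hf : IsDensityFamily μ f) (π : Measure Θ) [IsProbabilityMeasure π] :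
    PtauGe π μ f ψ 1 = 1 := by
  simp [PtauGe, t, hf.2.2.1]

variable [SigmaFinite μ]

lemma lintegral_mul_fbar (hf : IsDensityFamily μ f) (π : Measure Θ) [SFinite π] (n : ℕ)
    {g : (Fin n → X) → ℝ≥0∞} (hg : Measurable g) :
    ∫⁻ x, g x * fbar π f n x ∂pm μ n = ∫⁻ θ, ∫⁻ x, g x * f θ n x ∂pm μ n ∂π := by
  rw [lintegral_lintegral_swap
    (((hg.comp measurable_snd).mul (hf.1 n)).aemeasurable)]
  refine lintegral_congr fun x => ?_
  exact (lintegral_const_mul _ ((hf.1 n).comp measurable_prodMk_right)).symm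

lemma PtauEq_add_PtauGe_succ (hf : IsDensityFamily μ f) (hψ : IsStoppingRule ψ)
    (π : Measure Θ) [SFinite π] (n : ℕ) :
    PtauEq π μ f ψ (n + 1) + PtauGe π μ f ψ (n + 2) = PtauGe π μ f ψ (n + 1) := by
  have hs : Measurable (s ψ (n + 1)) := (measurable_t hψ _).mul (hψ.1 _)
  have h1 : Measurable fun p : Θ × (Fin (n + 1) → X) => s ψ (n + 1) p.2 * f p.1 (n + 1) p.2 :=
    (hs.comp measurable_snd).mul (hf.1 _)
  unfold PtauEq PtauGe
  rw [← lintegral_add_left h1.lintegral_prod_right']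
  refine lintegral_congr fun θ => ?_
  have h2 : Measurable fun x => t ψ (n + 2) x * f θ (n + 2) x :=
    (measurable_t hψ _).mul (hf.measurable_apply θ _)
  have h3 : Measurable fun x => s ψ (n + 1) x * f θ (n + 1) x :=
    hs.mul (hf.measurable_apply θ _)
  rw [lintegral_pm_succ μ (n + 1) h2, ← lintegral_add_left h3]
  refine lintegral_congr fun x => ?_
  have hsnoc : Measurable fun y : X => (Fin.snoc x y : Fin (n + 2) → X) := by
    refine measurable_pi_lambda _ fun i => ?_
    refine Fin.lastCases ?_ (fun j => ?_) i
    · simpa using measurable_id'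
    · simp
  simp only [t, Fin.init_snoc, s]
  have h4 : Measurable fun y => f θ (n + 2) (Fin.snoc x y) :=
    (hf.measurable_apply θ _).comp hsnoc
  rw [lintegral_const_mul _ h4, hf.2.2.2, ← add_mul,
    ← mul_add, add_tsub_cancel_of_le (hψ.2 _ _), mul_one]

lemma sum_PtauEq_add_PtauGe (hf : IsDensityFamily μ f) (hψ : IsStoppingRule ψ)
    (π : Measure Θ) [IsProbabilityMeasure π] (N : ℕ) :
    ∑ n ∈ Finset.range N, PtauEq π μ f ψ (n + 1) + PtauGe π μ f ψ (N + 1) = 1 := by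
  induction N with
  | zero => simpa using PtauGe_one hf π
  | succ N ih => rwa [Finset.sum_range_succ, add_assoc, PtauEq_add_PtauGe_succ hf hψ]

lemma one_sub_Pfin_le_PtauGe (hf : IsDensityFamily μ f) (hψ : IsStoppingRule ψ)
    (π : Measure Θ) [IsProbabilityMeasure π] (N : ℕ) :
    1 - Pfin π μ f ψ ≤ PtauGe π μ f ψ (N + 1) := by
  rw [tsub_le_iff_left, ← sum_PtauEq_add_PtauGe hf hψ π N]
  gcongr
  exact ENNReal.sum_le_tsum _

lemma Pfin_le_one (hf : IsDensityFamily μ f) (hψ : IsStoppingRule ψ)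
    (π : Measure Θ) [IsProbabilityMeasure π] : Pfin π μ f ψ ≤ 1 := by
  refine ENNReal.tsum_le_of_sum_range_le fun N => ?_
  rw [← sum_PtauEq_add_PtauGe hf hψ π N]
  exact le_self_add

lemma PtauGe_eq_tsum (hf : IsDensityFamily μ f) (hψ : IsStoppingRule ψ)
    (π : Measure Θ) [IsProbabilityMeasure π] (h : Pfin π μ f ψ = 1) (N : ℕ) :
    PtauGe π μ f ψ (N + 1) = ∑' k, PtauEq π μ f ψ (k + N + 1) := by
  have h1 := sum_PtauEq_add_PtauGe hf hψ π N
  have h2 := Summable.sum_add_tsum_nat_add' (f := fun n => PtauEq π μ f ψ (n + 1)) (k := N)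
    ENNReal.summable
  have hfin : ∑ n ∈ Finset.range N, PtauEq π μ f ψ (n + 1) ≠ ⊤ :=
    ne_top_of_le_ne_top one_ne_top (h1 ▸ le_self_add)
  rw [show ∑' n, PtauEq π μ f ψ (n + 1) = 1 from h, ← h1] at h2
  exact ((ENNReal.add_right_inj hfin).1 h2).symm

lemma tendsto_PtauGe_zero (hf : IsDensityFamily μ f) (hψ : IsStoppingRule ψ)
    (π : Measure Θ) [IsProbabilityMeasure π] (h : Pfin π μ f ψ = 1) :
    Tendsto (fun N => PtauGe π μ f ψ (N + 1)) atTop (nhds 0) := by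
  simp_rw [PtauGe_eq_tsum hf hψ π h]
  exact ENNReal.tendsto_sum_nat_add (fun n => PtauEq π μ f ψ (n + 1))
    (show Pfin π μ f ψ ≠ ⊤ by simp [h])

lemma tendsto_mul_PtauGe_zero (hf : IsDensityFamily μ f) (hψ : IsStoppingRule ψ)
    (π : Measure Θ) [IsProbabilityMeasure π] (h : Pfin π μ f ψ = 1) (c : ℝ≥0∞)
    (hsum : ∑' n : ℕ, c * ((n : ℝ≥0∞) + 1) * PtauEq π μ f ψ (n + 1) ≠ ⊤) :
    Tendsto (fun N : ℕ => c * ((N : ℝ≥0∞) + 1) * PtauGe π μ f ψ (N + 1)) atTop (nhds 0) := by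
  refine tendsto_of_tendsto_of_tendsto_of_le_of_le tendsto_const_nhds
    (ENNReal.tendsto_sum_nat_add _ hsum) (fun _ => zero_le) fun N => ?_
  simp only [PtauGe_eq_tsum hf hψ π h, ← ENNReal.tsum_mul_left]
  gcongr
  omega

/-- The cost of continuing past `N` splits into the sampling cost and the terminal loss. -/
lemma lintegral_t_mul (hf : IsDensityFamily μ f) (hψ : IsStoppingRule ψ)
    (π : Measure Θ) [SFinite π] (a : ℝ≥0∞) (n : ℕ) (g : (Fin n → X) → ℝ≥0∞) :
    ∫⁻ x, t ψ n x * (a * fbar π f n x + g x) ∂pm μ n =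
      a * PtauGe π μ f ψ n + ∫⁻ x, t ψ n x * g x ∂pm μ n := by
  have ht := measurable_t hψ n
  have hm : Measurable fun x => t ψ n x * fbar π f n x := ht.mul (hf.measurable_fbar π n)
  simp_rw [mul_add, mul_left_comm _ a]
  rw [lintegral_add_left (hm.const_mul a), lintegral_const_mul _ hm,
    lintegral_mul_fbar hf π n ht, PtauGe]

lemma mul_PtauEq_le (hf : IsDensityFamily μ f) (hψ : IsStoppingRule ψ)
    (π : Measure Θ) [SFinite π] (a : ℝ≥0∞) (n : ℕ) (g : (Fin n → X) → ℝ≥0∞) :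
    a * PtauEq π μ f ψ n ≤ ∫⁻ x, s ψ n x * (a * fbar π f n x + g x) ∂pm μ n := by
  have hs : Measurable (s ψ n) := (measurable_t hψ _).mul (hψ.1 _)
  have hm : Measurable fun x => s ψ n x * fbar π f n x := hs.mul (hf.measurable_fbar π n)
  rw [PtauEq, ← lintegral_mul_fbar hf π n hs, ← lintegral_const_mul _ hm]
  refine lintegral_mono fun x => ?_
  simp only [mul_add, mul_left_comm _ a]
  exact le_self_add

lemma lintegral_t_mul_le (hf : IsDensityFamily μ f) (hψ : IsStoppingRule ψ)
    (π : Measure Θ) [SFinite π] (M : ℝ≥0∞) (n : ℕ) {g : (Fin n → X) → ℝ≥0∞}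
    (hg : ∀ x, g x ≤ M * fbar π f n x) :
    ∫⁻ x, t ψ n x * g x ∂pm μ n ≤ M * PtauGe π μ f ψ n := by
  calc ∫⁻ x, t ψ n x * g x ∂pm μ n
      ≤ ∫⁻ x, t ψ n x * (M * fbar π f n x + 0) ∂pm μ n := by
        gcongr with x
        simpa using hg x
    _ = M * PtauGe π μ f ψ n := by rw [lintegral_t_mul hf hψ π M n (fun _ => 0)]; simp

end

end SDP

open SDP MeasureTheory ENNReal Filter in
/-- if the loss function is bounded and `R(ψ) < ∞` implies
`P^{π₁}(τ_ψ < ∞) = 1`, then every stopping rule is truncatable. -/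
theorem statement_12
    {Θ X D : Type*} [MeasurableSpace Θ] [MeasurableSpace X] [MeasurableSpace D]
    (μ : Measure X) [SigmaFinite μ]
    (π₁ π₂ : Measure Θ) [IsProbabilityMeasure π₁] [IsProbabilityMeasure π₂]
    (f : Θ → ∀ n, (Fin n → X) → ℝ≥0∞) (hf : IsDensityFamily μ f)
    (w : Θ → D → ℝ≥0∞) (hw : Measurable (Function.uncurry w))
    (M : ℝ≥0∞) (hM : M ≠ ⊤) (hwb : ∀ θ d, w θ d ≤ M)
    (δB : ∀ n, (Fin n → X) → D) (hδB : IsDecisionRule δB)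
    (hBayes : ∀ n (d : D), ∀ᵐ x ∂pm μ n,
      ∫⁻ θ, w θ (δB n x) * f θ n x ∂π₁ ≤ ∫⁻ θ, w θ d * f θ n x ∂π₁)
    (l : ∀ n, (Fin n → X) → ℝ≥0∞)
    (hl : ∀ n x, l n x = ∫⁻ θ, w θ (δB n x) * f θ n x ∂π₁)
    (hl1 : ∫⁻ x, l 1 x ∂pm μ 1 < ⊤)
    (c : ℝ≥0∞) (hc : 0 < c) (hc' : c ≠ ⊤)
    -- R(ψ) < ∞ implies P^{π₁}(τ_ψ < ∞) = 1
    (hP : ∀ ψ : ∀ n, (Fin n → X) → ℝ≥0∞, IsStoppingRule ψ →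
      R π₂ μ c f l ψ < ⊤ → Pfin π₁ μ f ψ = 1) :
    ∀ ψ : ∀ n, (Fin n → X) → ℝ≥0∞, IsStoppingRule ψ →
      Tendsto (fun N => RN π₂ μ c f l N ψ) atTop (nhds (R π₂ μ c f l ψ)) := by
  intro ψ hψ
  rw [← tendsto_add_atTop_iff_nat 1]
  have hRN : ∀ N : ℕ, RN π₂ μ c f l (N + 1) ψ =
      (∑ n ∈ Finset.range N, ∫⁻ x, s ψ (n + 1) x *
        (c * ((n : ℝ≥0∞) + 1) * fbar π₂ f (n + 1) x + l (n + 1) x) ∂pm μ (n + 1)) +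
      (c * ((N : ℝ≥0∞) + 1) * PtauGe π₂ μ f ψ (N + 1) +
        ∫⁻ x, t ψ (N + 1) x * l (N + 1) x ∂pm μ (N + 1)) := by
    intro N
    rw [RN, lintegral_t_mul hf hψ]
    simp
  simp_rw [hRN]
  by_cases hfin : Pfin π₂ μ f ψ = 1
  · have hR : R π₂ μ c f l ψ = ∑' n : ℕ, ∫⁻ x, s ψ (n + 1) x *
        (c * ((n : ℝ≥0∞) + 1) * fbar π₂ f (n + 1) x + l (n + 1) x) ∂pm μ (n + 1) := by
      rw [R, if_pos hfin]
    have hsum := ENNReal.tendsto_nat_tsum fun n : ℕ => ∫⁻ x, s ψ (n + 1) x *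
        (c * ((n : ℝ≥0∞) + 1) * fbar π₂ f (n + 1) x + l (n + 1) x) ∂pm μ (n + 1)
    rw [← hR] at hsum
    by_cases htop : R π₂ μ c f l ψ = ⊤
    · rw [htop] at hsum ⊢
      exact tendsto_nhds_top_mono' hsum fun N => le_self_add
    · have h1 := hP ψ hψ (lt_top_iff_ne_top.2 htop)
      have hcost := tendsto_mul_PtauGe_zero hf hψ π₂ hfin c
        (ne_top_of_le_ne_top htop (hR ▸ ENNReal.tsum_le_tsum fun n =>
          mul_PtauEq_le hf hψ π₂ _ (n + 1) (l (n + 1))))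
      have hMP : Tendsto (fun N => M * PtauGe π₁ μ f ψ (N + 1)) atTop (nhds 0) := by
        simpa using ENNReal.Tendsto.const_mul (tendsto_PtauGe_zero hf hψ π₁ h1) (Or.inr hM)
      have hloss : Tendsto (fun N => ∫⁻ x, t ψ (N + 1) x * l (N + 1) x ∂pm μ (N + 1))
          atTop (nhds 0) := by
        refine tendsto_of_tendsto_of_tendsto_of_le_of_le tendsto_const_nhds hMP
          (fun _ => zero_le) fun N => lintegral_t_mul_le hf hψ π₁ M _ fun x => ?_
        have hm : Measurable fun θ => f θ (N + 1) x := (hf.1 _).comp measurable_prodMk_right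
        rw [hl, fbar, ← lintegral_const_mul _ hm]
        exact lintegral_mono fun θ => mul_le_mul_left (hwb _ _) _
      simpa using hsum.add (hcost.add hloss)
  · rw [R, if_neg hfin]
    have hε : 1 - Pfin π₂ μ f ψ ≠ 0 :=
      (tsub_pos_of_lt (lt_of_le_of_ne (Pfin_le_one hf hψ π₂) hfin)).ne'
    have hlin : Tendsto (fun N : ℕ => c * (N : ℝ≥0∞) * (1 - Pfin π₂ μ f ψ)) atTop (nhds ⊤) := by
      have h := ENNReal.Tendsto.const_mul (a := c) ENNReal.tendsto_nat_nhds_top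
        (Or.inl ENNReal.top_ne_zero)
      rw [ENNReal.mul_top hc.ne'] at h
      have h' := ENNReal.Tendsto.mul_const (b := 1 - Pfin π₂ μ f ψ) h
        (Or.inl ENNReal.top_ne_zero)
      rwa [ENNReal.top_mul hε] at h'
    refine tendsto_nhds_top_mono' hlin fun N => ?_
    refine le_trans ?_ le_add_self
    refine le_trans ?_ le_self_add
    gcongr
    · exact le_self_add
    · exact one_sub_Pfin_le_PtauGe hf hψ π₂ N
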